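/- For every x ∈ ℝⁿ with x_i ≠ 0 for all i ∈ {1,…,n}, the function Φ₀ is twice differentiable at x, its gradient satisfies DΦ₀(x) = −|x|_b^{−(a+1)}·x^{b−1}, and its Hessian matrix satisfies D²Φ₀(x) = b(a+1)·|x|_b^{−(a+2)}·(x^{b−1} ⊗ x^{b−1}) − (b−1)·|x|_b^{−(a+1)}·diag(|x₁|^{b−2},…,|xₙ|^{b−2}), where v ⊗ w denotes the matrix (v_i w_j)_{i,j}. -/

import Mathlib

noncomputable section

/-- Euclidean space ℝⁿ. -/
abbrev En (n : ℕ) := EuclideanSpace ℝ (Fin n)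

/-- The gradient vector `Dψ(x)` of coordinatewise partial derivatives. -/
noncomputable def gradVec {n : ℕ} (ψ : En n → ℝ) (x : En n) : Fin n → ℝ :=
  fun i => fderiv ℝ ψ x (EuclideanSpace.single i 1)

/-- The Hessian matrix `D²ψ(x)` of second partial derivatives. -/
noncomputable def hessMat {n : ℕ} (ψ : En n → ℝ) (x : En n) : Matrix (Fin n) (Fin n) ℝ :=
  Matrix.of fun i j =>
    fderiv ℝ (fun y => fderiv ℝ ψ y (EuclideanSpace.single j 1)) x (EuclideanSpace.single i 1)

/-- The exponent `b = 1 + 1/(1+p)`. -/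
noncomputable def bexp (p : ℝ) : ℝ := 1 + 1 / (1 + p)

/-- `|x|_s = Σᵢ |xᵢ|^s`. -/
noncomputable def normS {n : ℕ} (s : ℝ) (x : En n) : ℝ := ∑ i, |x i| ^ s

/-- `x^s`, the vector with components `|xᵢ|^{s−1}·xᵢ`. -/
noncomputable def vpowS {n : ℕ} (s : ℝ) (x : En n) : Fin n → ℝ := fun i => |x i| ^ (s - 1) * x i

/-- The barrier function `Φ₀(x) = (1/(ab))·(Σᵢ |xᵢ|^b)^{−a}` with `b = 1 + 1/(1+p)`. -/
noncomputable def Phi0 (n : ℕ) (p a : ℝ) (x : En n) : ℝ :=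
  (1 / (a * bexp p)) * (∑ i, |x i| ^ bexp p) ^ (-a)

/-- Away from zero, the derivative of `|t|^s` is `s |t|^(s-2) t`. -/
theorem hasDerivAt_abs_rpow_const (s : ℝ) {t : ℝ} (ht : t ≠ 0) :
    HasDerivAt (fun t : ℝ => |t| ^ s) (s * (|t| ^ (s - 2) * t)) t := by
  have habs : |t| ≠ 0 := abs_ne_zero.2 ht
  have h := (hasDerivAt_abs ht).rpow_const (p := s) (Or.inl habs)
  convert h using 1
  have h1 : |t| ^ (s - 1) = |t| ^ (s - 2) * |t| := by
    rw [← Real.rpow_add_one habs]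
    ring_nf
  rw [h1]
  linear_combination (-(s * |t| ^ (s - 2))) * sign_mul_abs t

/-- Away from zero, the derivative of `|t|^(s-1) t` is `s |t|^(s-1)`. -/
theorem hasDerivAt_abs_rpow_sub_one_mul_self (s : ℝ) {t : ℝ} (ht : t ≠ 0) :
    HasDerivAt (fun t : ℝ => |t| ^ (s - 1) * t) (s * |t| ^ (s - 1)) t := by
  have habs : |t| ≠ 0 := abs_ne_zero.2 ht
  have h := (hasDerivAt_abs_rpow_const (s - 1) ht).mul (hasDerivAt_id t)
  refine h.congr_deriv ?_
  have h1 : |t| ^ (s - 1) = |t| ^ (s - 1 - 2) * t ^ 2 := by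
    rw [← sq_abs, ← Real.rpow_natCast, ← Real.rpow_add (abs_pos.2 ht)]
    norm_num
  simp only [id_eq]
  linear_combination (-(s - 1)) * h1

theorem normS_pos {n : ℕ} (hn : 1 ≤ n) (s : ℝ) {x : En n} (hx : ∀ i, x i ≠ 0) :
    0 < normS s x := by
  have : Nonempty (Fin n) := ⟨⟨0, hn⟩⟩
  exact Finset.sum_pos (fun i _ => Real.rpow_pos_of_pos (abs_pos.2 (hx i)) s)
    Finset.univ_nonempty

theorem hasFDerivAt_coord {n : ℕ} (x : En n) (i : Fin n) :
    HasFDerivAt (fun y : En n => y i) (EuclideanSpace.proj i : En n →L[ℝ] ℝ) x :=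
  (EuclideanSpace.proj i : En n →L[ℝ] ℝ).hasFDerivAt

theorem hasFDerivAt_normS {n : ℕ} (s : ℝ) {x : En n} (hx : ∀ i, x i ≠ 0) :
    HasFDerivAt (normS s)
      (∑ i, (s * vpowS (s - 1) x i) • (EuclideanSpace.proj i : En n →L[ℝ] ℝ)) x := by
  unfold normS vpowS
  refine HasFDerivAt.fun_sum fun i _ => ?_
  rw [sub_sub, one_add_one_eq_two]
  have h := (hasDerivAt_abs_rpow_const s (hx i)).comp_hasFDerivAt x (hasFDerivAt_coord x i)
  exact h

theorem hasFDerivAt_normS_rpow {n : ℕ} (hn : 1 ≤ n) (s r : ℝ) {x : En n} (hx : ∀ i, x i ≠ 0) :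
    HasFDerivAt (fun y => normS s y ^ r)
      ((r * normS s x ^ (r - 1)) •
        ∑ i, (s * vpowS (s - 1) x i) • (EuclideanSpace.proj i : En n →L[ℝ] ℝ)) x :=
  (hasFDerivAt_normS s hx).rpow_const (Or.inl (normS_pos hn s hx).ne')

theorem hasFDerivAt_vpowS {n : ℕ} (s : ℝ) {x : En n} (j : Fin n) (hx : x j ≠ 0) :
    HasFDerivAt (fun y => vpowS s y j)
      ((s * |x j| ^ (s - 1)) • (EuclideanSpace.proj j : En n →L[ℝ] ℝ)) x := by
  have h := (hasDerivAt_abs_rpow_sub_one_mul_self s hx).comp_hasFDerivAt x (hasFDerivAt_coord x j)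
  exact h

theorem sum_smul_proj_apply_single {n : ℕ} (c : Fin n → ℝ) (j : Fin n) :
    (∑ i, c i • (EuclideanSpace.proj i : En n →L[ℝ] ℝ)) (EuclideanSpace.single j 1) = c j := by
  simp

theorem contDiffAt_Phi0 {n : ℕ} (hn : 1 ≤ n) (p a : ℝ) {x : En n} (hx : ∀ i, x i ≠ 0) :
    ContDiffAt ℝ 2 (Phi0 n p a) x := by
  refine contDiffAt_const.mul (ContDiffAt.rpow_const_of_ne ?_ (normS_pos hn _ hx).ne')
  refine ContDiffAt.sum fun i _ => ContDiffAt.rpow_const_of_ne ?_ (abs_ne_zero.2 (hx i))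
  exact (contDiffAt_abs (hx i)).comp x
    (EuclideanSpace.proj i : En n →L[ℝ] ℝ).contDiff.contDiffAt

theorem fderiv_Phi0_single {n : ℕ} (hn : 1 ≤ n) {p a : ℝ} (hp : 0 ≤ p) (ha : 0 < a)
    {x : En n} (hx : ∀ i, x i ≠ 0) (j : Fin n) :
    fderiv ℝ (Phi0 n p a) x (EuclideanSpace.single j 1)
      = -(normS (bexp p) x ^ (-(a + 1))) * vpowS (bexp p - 1) x j := by
  have hb : bexp p ≠ 0 := by
    unfold bexp
    positivity
  have h : HasFDerivAt (Phi0 n p a) _ x :=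
    (hasFDerivAt_normS_rpow hn (bexp p) (-a) hx).const_mul (1 / (a * bexp p))
  rw [h.fderiv, smul_apply, smul_apply,
    sum_smul_proj_apply_single, show -a - 1 = -(a + 1) by ring]
  simp only [smul_eq_mul]
  field_simp

theorem eventually_forall_coord_ne_zero {n : ℕ} {x : En n} (hx : ∀ i, x i ≠ 0) :
    ∀ᶠ y in nhds x, ∀ i, y i ≠ 0 :=
  Filter.eventually_all.2 fun i => (hasFDerivAt_coord x i).continuousAt.eventually_ne (hx i)

theorem fderiv_fderiv_Phi0_single {n : ℕ} (hn : 1 ≤ n) {p a : ℝ} (hp : 0 ≤ p) (ha : 0 < a)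
    {x : En n} (hx : ∀ i, x i ≠ 0) (i j : Fin n) :
    fderiv ℝ (fun y => fderiv ℝ (Phi0 n p a) y (EuclideanSpace.single j 1)) x
        (EuclideanSpace.single i 1)
      = bexp p * (a + 1) * normS (bexp p) x ^ (-(a + 2)) *
          (vpowS (bexp p - 1) x i * vpowS (bexp p - 1) x j)
        - (bexp p - 1) * normS (bexp p) x ^ (-(a + 1)) *
          Matrix.diagonal (fun i => |x i| ^ (bexp p - 2)) i j := by
  have heq : (fun y => fderiv ℝ (Phi0 n p a) y (EuclideanSpace.single j 1)) =ᶠ[nhds x]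
      fun y => -(normS (bexp p) y ^ (-(a + 1))) * vpowS (bexp p - 1) y j :=
    (eventually_forall_coord_ne_zero hx).mono fun y hy => fderiv_Phi0_single hn hp ha hy j
  have h := (hasFDerivAt_normS_rpow hn (bexp p) (-(a + 1)) hx).fun_neg.fun_mul
    (hasFDerivAt_vpowS (bexp p - 1) j (hx j))
  rw [heq.fderiv_eq, h.fderiv, add_apply, smul_apply,
    smul_apply, smul_apply, neg_apply,
    smul_apply, sum_smul_proj_apply_single,
    show -(a + 1) - 1 = -(a + 2) by ring, show bexp p - 1 - 1 = bexp p - 2 by ring]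
  rcases eq_or_ne i j with rfl | hij
  · simp
    ring
  · simp [hij, hij.symm]
    ring

/-- Gradient and Hessian of the barrier `Φ₀`: at every point all of whose coordinates are
nonzero, `Φ₀` is twice differentiable with `DΦ₀(x) = −|x|_b^{−(a+1)}·x^{b−1}` and
`D²Φ₀(x) = b(a+1)|x|_b^{−(a+2)}(x^{b−1} ⊗ x^{b−1}) − (b−1)|x|_b^{−(a+1)}·diag(|xᵢ|^{b−2})`. -/
theorem Phi0_grad_hess (n : ℕ) (hn : 1 ≤ n) (p a : ℝ) (hp : 0 ≤ p) (ha : 0 < a)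
    (x : En n) (hx : ∀ i, x i ≠ 0) :
    ContDiffAt ℝ 2 (Phi0 n p a) x ∧
    (gradVec (Phi0 n p a) x
      = fun i => -(normS (bexp p) x ^ (-(a + 1))) * vpowS (bexp p - 1) x i) ∧
    hessMat (Phi0 n p a) x
      = (bexp p * (a + 1) * normS (bexp p) x ^ (-(a + 2))) •
          Matrix.vecMulVec (vpowS (bexp p - 1) x) (vpowS (bexp p - 1) x)
        - ((bexp p - 1) * normS (bexp p) x ^ (-(a + 1))) •
            Matrix.diagonal (fun i => |x i| ^ (bexp p - 2)) := by
  refine ⟨contDiffAt_Phi0 hn p a hx, funext fun i => fderiv_Phi0_single hn hp ha hx i, ?_⟩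
  ext i j
  exact fderiv_fderiv_Phi0_single hn hp ha hx i j
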